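/- arXiv:0905.0092 — 2 statements merged into one kernel-verified Lean document; each statement's English description precedes it below -/
import Mathlib

section
/- Let H be a real Hilbert space, φ : H → ℝ a convex differentiable function whose gradient ∇φ is Lipschitz continuous on bounded sets, A : H → H a maximal monotone λ-cocoercive operator (λ > 0), γ > 0 with λγ² > 1, and S := (∇φ + A)⁻¹(0) nonempty. Let Θ : H → ℝ be a differentiable convex function bounded below with ∇Θ δ-Lipschitz continuous and η-strongly monotone (δ, η > 0), and let ε : [0,∞) → (0,∞) be a C¹ decreasing function with ε(t) → 0 as t → +∞ and ∫₀^∞ ε(s) ds = ∞. Then for any u₀, v₀ ∈ H, the unique solution u ∈ C²([0,∞); H) of ü(t) + γ u̇(t) + ∇φ(u(t)) + A(u(t)) + ε(t) ∇Θ(u(t)) = 0 with u(0) = u₀, u̇(0) = v₀ converges strongly in H, as t → +∞, to u_*, the unique solution of the variational inequality: u_* ∈ S and ⟨∇Θ(u_*), v − u_*⟩ ≥ 0 for all v ∈ S. -/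
open Filter MeasureTheory Set Bornology
open scoped RealInnerProductSpace NNReal Topology ENNReal

/-- The gradient inequality for a convex differentiable function. -/
theorem ConvexOn.add_inner_le_of_hasGradientAt {H : Type*} [NormedAddCommGroup H]
    [InnerProductSpace ℝ H] [CompleteSpace H] {f : H → ℝ} {g x : H}
    (hf : ConvexOn ℝ univ f) (hg : HasGradientAt f g x) (y : H) :
    f x + ⟪g, y - x⟫ ≤ f y := by
  have hconv : ConvexOn ℝ univ (f ∘ AffineMap.lineMap (k := ℝ) x y) := by
    simpa using hf.comp_affineMap (AffineMap.lineMap (k := ℝ) x y)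
  have hder : HasDerivAt (f ∘ AffineMap.lineMap (k := ℝ) x y) ⟪g, y - x⟫ 0 := by
    have h0 : HasFDerivAt f (InnerProductSpace.toDual ℝ H g)
        (AffineMap.lineMap (k := ℝ) x y (0 : ℝ)) := by
      simpa using hg.hasFDerivAt
    simpa using h0.comp_hasDerivAt (0 : ℝ) AffineMap.hasDerivAt_lineMap
  have := hconv.le_slope_of_hasDerivAt (mem_univ 0) (mem_univ 1) zero_lt_one hder
  simp only [slope, sub_zero, inv_one, one_smul, vsub_eq_sub, Function.comp_apply,
    AffineMap.lineMap_apply_one, AffineMap.lineMap_apply_zero] at this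
  linarith

/-- Bounded sequences in a Hilbert space converge weakly along some nontrivial ultrafilter. -/
theorem exists_ultrafilter_tendsto_inner {H : Type*} [NormedAddCommGroup H]
    [InnerProductSpace ℝ H] [CompleteSpace H] {x : ℕ → H} {R : ℝ} (hx : ∀ n, ‖x n‖ ≤ R) :
    ∃ (F : Ultrafilter ℕ) (z : H), (F : Filter ℕ) ≤ atTop ∧
      ∀ w, Tendsto (fun n => ⟪w, x n⟫) F (𝓝 ⟪w, z⟫) := by
  let J : H → WeakDual ℝ H := fun v => StrongDual.toWeakDual (InnerProductSpace.toDual ℝ H v)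
  have hJ : ∀ n, J (x n) ∈
      WeakDual.toStrongDual ⁻¹' Metric.closedBall (0 : StrongDual ℝ H) R := by
    intro n
    simpa [J] using hx n
  obtain ⟨ℓ, -, hℓ⟩ := (WeakDual.isCompact_closedBall (𝕜 := ℝ)
    (0 : StrongDual ℝ H) R).ultrafilter_le_nhds ((hyperfilter ℕ).map (J ∘ x))
      (le_principal_iff.2 (Ultrafilter.mem_map.2 (Filter.univ_mem' hJ)))
  refine ⟨hyperfilter ℕ, (InnerProductSpace.toDual ℝ H).symm (WeakDual.toStrongDual ℓ),
    Nat.hyperfilter_le_atTop, fun w => ?_⟩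
  have h : Tendsto (J ∘ x) (hyperfilter ℕ : Filter ℕ) (𝓝 ℓ) := hℓ
  have h' := ((WeakDual.eval_continuous w).tendsto ℓ).comp h
  rw [real_inner_comm, InnerProductSpace.toDual_symm_apply]
  refine h'.congr fun n => ?_
  simp [J, real_inner_comm]

/-- A Grönwall-type comparison for `f' ≤ e (a - α f)`, where `G' = e`. -/
theorem le_add_mul_exp_of_hasDerivAt_le {G e f f' : ℝ → ℝ} {T a α : ℝ} (hα : 0 < α)
    (hG : ∀ t, T ≤ t → HasDerivAt G (e t) t) (hf : ∀ t, T ≤ t → HasDerivAt f (f' t) t)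
    (h : ∀ t, T ≤ t → f' t ≤ e t * (a - α * f t)) {t : ℝ} (ht : T ≤ t) :
    f t ≤ a / α + (f T - a / α) * Real.exp (-(α * (G t - G T))) := by
  have hd : ∀ s, T ≤ s → HasDerivAt (fun s => (f s - a / α) * Real.exp (α * (G s - G T)))
      (f' s * Real.exp (α * (G s - G T)) +
        (f s - a / α) * (Real.exp (α * (G s - G T)) * (α * e s))) s := fun s hs =>
    ((hf s hs).sub_const _).mul (((hG s hs).sub_const _).const_mul α).exp
  have hanti : AntitoneOn (fun s => (f s - a / α) * Real.exp (α * (G s - G T))) (Ici T) := by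
    refine antitoneOn_of_hasDerivWithinAt_nonpos (convex_Ici T)
      (fun s hs => (hd s hs).continuousAt.continuousWithinAt)
      (fun s hs => (hd s (interior_subset hs)).hasDerivWithinAt) fun s hs => ?_
    have h1 := h s (interior_subset hs)
    have h2 : f' s + (f s - a / α) * (α * e s) ≤ 0 := by
      have : (f s - a / α) * (α * e s) = - (e s * (a - α * f s)) := by field_simp; ring
      linarith
    nlinarith [Real.exp_pos (α * (G s - G T))]
  have h3 := hanti self_mem_Ici ht ht
  simp only [sub_self, mul_zero, Real.exp_zero, mul_one] at h3
  rw [Real.exp_neg, ← div_eq_mul_inv]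
  have := (le_div_iff₀ (Real.exp_pos (α * (G t - G T)))).2 h3
  linarith

/-- The running integral of a positive continuous function on `[0, ∞)` with infinite integral
has derivative `ε` on `(0, ∞)` and tends to infinity. -/
theorem exists_hasDerivAt_tendsto_atTop {ε : ℝ → ℝ} (hc : ContinuousOn ε (Ici 0))
    (hpos : ∀ t ∈ Ici (0 : ℝ), 0 < ε t)
    (hdiv : (∫⁻ t in Ici (0 : ℝ), ENNReal.ofReal (ε t)) = ∞) :
    ∃ G : ℝ → ℝ, (∀ t, 0 < t → HasDerivAt G (ε t) t) ∧ Monotone G ∧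
      Tendsto G atTop atTop := by
  let e : ℝ → ℝ := fun t => ε (max t 0)
  have hec : Continuous e :=
    hc.comp_continuous (continuous_id.max continuous_const) fun t => le_max_right t 0
  have hepos : ∀ t, 0 < e t := fun t => hpos _ (le_max_right t 0)
  have hd : ∀ t, HasDerivAt (fun t => ∫ s in (0 : ℝ)..t, e s) (e t) t := fun t =>
    intervalIntegral.integral_hasDerivAt_right (hec.intervalIntegrable _ _)
      hec.stronglyMeasurable.stronglyMeasurableAtFilter hec.continuousAt
  have hmono : Monotone fun t => ∫ s in (0 : ℝ)..t, e s :=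
    monotone_of_hasDerivAt_nonneg hd fun t => (hepos t).le
  refine ⟨_, fun t ht => ?_, hmono, (tendsto_atTop_of_monotone hmono).resolve_right ?_⟩
  · simpa [e, max_eq_left ht.le] using hd t
  · rintro ⟨l, hl⟩
    have hint : IntegrableOn e (Ioi 0) :=
      integrableOn_Ioi_of_intervalIntegral_norm_tendsto l 0
        (fun i => (hec.integrableOn_Icc).mono_set Ioc_subset_Icc_self) tendsto_id
        (by simpa [abs_of_pos (hepos _)] using hl)
    have hfin := hint.lintegral_lt_top
    rw [← setLIntegral_congr Ioi_ae_eq_Ici.symm] at hfin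
    refine hfin.ne (Eq.trans ?_ hdiv)
    exact setLIntegral_congr_fun measurableSet_Ici fun t ht => by
      simp [e, max_eq_left (mem_Ici.1 ht)]

/-- The pointwise dissipation estimate for the energy `s + γ/2 x² + 2λγ (y²/2 + F)`. -/
theorem exists_dissipation_estimate {lam γ δ η M : ℝ} (hγ : 0 < γ) (hlam : 0 < lam)
    (hcond : 1 < lam * γ ^ 2) (hδ : 0 < δ) (hη : 0 < η) :
    ∃ α μ C e₀ : ℝ, 0 < α ∧ 0 < μ ∧ 0 ≤ C ∧ 0 < e₀ ∧
      ∀ {e x y b q F g P R Q Z s : ℝ}, 0 < e → e ≤ e₀ → 0 ≤ F → F ≤ q → s ≤ x * y →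
        lam * b ^ 2 ≤ P → η * x ^ 2 + g ≤ R → -(b * y) ≤ Q → -((M + δ * x) * y) ≤ Z →
        y ^ 2 - q - P - e * R - 2 * lam * γ * (γ * y ^ 2 + Q + e * Z) ≤
          e * (C * e - g - α * (s + γ / 2 * x ^ 2 + 2 * lam * γ * (y ^ 2 / 2 + F))) -
            μ * (b ^ 2 + q) := by
  have hc : 0 < 2 * lam * γ := by positivity
  obtain ⟨c, hcdef⟩ : ∃ c, c = 2 * lam * γ := ⟨_, rfl⟩
  rw [← hcdef] at hc ⊢
  obtain ⟨κ, hκ, hκ1, hκ2⟩ : ∃ κ : ℝ, 0 < κ ∧ κ * (1 + 2 * γ ^ 2) ≤ lam * γ ^ 2 - 1 ∧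
      2 * κ ≤ lam := by
    have h1 : 0 < 1 + 2 * γ ^ 2 := by positivity
    refine ⟨min ((lam * γ ^ 2 - 1) / (1 + 2 * γ ^ 2)) (lam / 2), lt_min ?_ ?_, ?_, ?_⟩
    · exact div_pos (by linarith) h1
    · positivity
    · exact (le_div_iff₀ h1).1 (min_le_left _ _)
    · linarith [min_le_right ((lam * γ ^ 2 - 1) / (1 + 2 * γ ^ 2)) (lam / 2)]
  have hK : 0 < 1 + γ + c := by positivity
  refine ⟨η / (2 * (1 + γ + c)), min κ (1 / 2), c ^ 2 * M ^ 2 / κ,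
    min (κ * η / (2 * c ^ 2 * δ ^ 2)) (min (κ / η) (1 / η)), by positivity, by positivity,
    by positivity, by positivity, ?_⟩
  intro e x y b q F g P R Q Z s he hle hF hFq hs hP hR hQ hZ
  have he1 : c ^ 2 * δ ^ 2 * e / κ ≤ η / 2 := by
    have := (le_div_iff₀ (by positivity)).1 (hle.trans (min_le_left _ _))
    rw [div_le_iff₀ hκ]; linarith
  have he2 : e * η ≤ κ :=
    (le_div_iff₀ hη).1 (hle.trans ((min_le_right _ _).trans (min_le_left _ _)))
  have he3 : e * η ≤ 1 :=
    (le_div_iff₀ hη).1 (hle.trans ((min_le_right _ _).trans (min_le_right _ _)))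
  have hq : 0 ≤ q := hF.trans hFq
  have hquad : y ^ 2 - P - c * (γ * y ^ 2 + Q) ≤ -(κ * (y ^ 2 + b ^ 2)) := by
    have h1 : b ^ 2 ≤ 2 * γ ^ 2 * y ^ 2 + 2 * (γ * y - b) ^ 2 := by
      nlinarith [sq_nonneg (2 * (γ * y) - b)]
    have h2 := mul_le_mul_of_nonneg_left h1 hκ.le
    have h3 := mul_le_mul_of_nonneg_right hκ1 (sq_nonneg y)
    have h4 := mul_le_mul_of_nonneg_right hκ2 (sq_nonneg (γ * y - b))
    have h5 := mul_le_mul_of_nonneg_left hQ hc.le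
    subst hcdef
    nlinarith
  have hcross : -(c * e * Z) ≤ κ / 2 * y ^ 2 + e * (η / 2 * x ^ 2) +
      e * (c ^ 2 * M ^ 2 / κ * e) := by
    have h1 := mul_le_mul_of_nonneg_left hZ (mul_pos hc he).le
    have h2 : c * e * ((M + δ * x) * y) ≤
        κ / 2 * y ^ 2 + (c * e) ^ 2 / κ * (M ^ 2 + δ ^ 2 * x ^ 2) := by
      have e1 : κ / 2 * y ^ 2 + (c * e) ^ 2 / κ * (M ^ 2 + δ ^ 2 * x ^ 2) -
          c * e * ((M + δ * x) * y) =
          (κ * y - c * e * (M + δ * x)) ^ 2 / (2 * κ) +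
            (c * e) ^ 2 * (M - δ * x) ^ 2 / (2 * κ) := by
        field_simp; ring
      have : 0 ≤ (κ * y - c * e * (M + δ * x)) ^ 2 / (2 * κ) +
            (c * e) ^ 2 * (M - δ * x) ^ 2 / (2 * κ) := by positivity
      linarith
    have h3 : (c * e) ^ 2 / κ * (M ^ 2 + δ ^ 2 * x ^ 2) =
        e * (c ^ 2 * δ ^ 2 * e / κ * x ^ 2) + e * (c ^ 2 * M ^ 2 / κ * e) := by
      field_simp; ring
    have h4 := mul_le_mul_of_nonneg_left
      (mul_le_mul_of_nonneg_right he1 (sq_nonneg x)) he.le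
    linarith
  have hW : e * (η / (2 * (1 + γ + c)) * (s + γ / 2 * x ^ 2 + c * (y ^ 2 / 2 + F))) ≤
      e * η / 2 * (x ^ 2 + y ^ 2 + F) := by
    have h1 : s + γ / 2 * x ^ 2 + c * (y ^ 2 / 2 + F) ≤
        (1 + γ + c) * (x ^ 2 + y ^ 2 + F) := by
      nlinarith [sq_nonneg (x - y), sq_nonneg x, sq_nonneg y, mul_nonneg hγ.le (sq_nonneg x),
        mul_nonneg hγ.le (sq_nonneg y), mul_nonneg hc.le (sq_nonneg x),
        mul_nonneg hc.le (sq_nonneg y), mul_nonneg hγ.le hF]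
    calc _ ≤ e * (η / (2 * (1 + γ + c)) * ((1 + γ + c) * (x ^ 2 + y ^ 2 + F))) := by gcongr
      _ = _ := by field_simp
  have h1 := mul_le_mul_of_nonneg_right he2 (sq_nonneg y)
  have h2 := mul_le_mul_of_nonneg_right he3 hF
  have h3 := mul_le_mul_of_nonneg_right (min_le_left κ (1 / 2)) (sq_nonneg b)
  have h4 := mul_le_mul_of_nonneg_right (min_le_right κ (1 / 2)) hq
  have h5 := mul_le_mul_of_nonneg_left hR he.le
  linarith

/-- Points at which the monotone inclusion residual is small almost satisfy the variational
inequality, uniformly on bounded sets. -/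
theorem exists_neg_le_inner_of_residual_le {H : Type*} [NormedAddCommGroup H]
    [InnerProductSpace ℝ H] [CompleteSpace H] {φ : H → ℝ} {φ' A : H → H}
    (hφconv : ConvexOn ℝ univ φ) (hφgrad : ∀ x, HasGradientAt φ (φ' x) x)
    (hAmono : ∀ v w : H, 0 ≤ ⟪A v - A w, v - w⟫)
    (hAmax : ∀ x y : H, (∀ v : H, 0 ≤ ⟪A v - y, v - x⟫) → y = A x)
    {p k : H} (hp : φ' p + A p = 0) (hVI : ∀ v, φ' v + A v = 0 → 0 ≤ ⟪k, v - p⟫)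
    (R : ℝ) {d : ℝ} (hd : 0 < d) :
    ∃ μ > 0, ∀ x : H, ‖x - p‖ ≤ R → ‖A x - A p‖ ^ 2 + ⟪φ' x - φ' p, x - p⟫ ≤ μ →
      -d ≤ ⟪k, x - p⟫ := by
  by_contra! hcon
  choose x hxR hxμ hxd using fun n : ℕ => hcon (1 / ((n : ℝ) + 1)) Nat.one_div_pos_of_nat
  obtain ⟨F, z, hF, hz⟩ := exists_ultrafilter_tendsto_inner hxR
  have hconv : ∀ w, Tendsto (fun n => ⟪w, x n - (p + z)⟫) F (𝓝 0) := by
    intro w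
    have := (hz w).sub_const ⟪w, z⟫
    simpa [← inner_sub_right, sub_sub] using this
  have hone : Tendsto (fun n : ℕ => 1 / ((n : ℝ) + 1)) F (𝓝 0) :=
    tendsto_one_div_add_atTop_nhds_zero_nat.mono_left hF
  have hgap : ∀ y, φ p + ⟪φ' p, y - p⟫ ≤ φ y :=
    fun y => hφconv.add_inner_le_of_hasGradientAt (hφgrad p) y
  have hgap' : ∀ y, φ y - φ p - ⟪φ' p, y - p⟫ ≤ ⟪φ' y - φ' p, y - p⟫ := by
    intro y
    have := hφconv.add_inner_le_of_hasGradientAt (hφgrad y) p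
    rw [← neg_sub y p, inner_neg_right] at this
    rw [inner_sub_left]
    linarith
  have hφz : φ (p + z) - φ p - ⟪φ' p, z⟫ ≤ 0 := by
    have hlim := hone.sub (hconv (φ' (p + z) - φ' p))
    rw [sub_zero] at hlim
    refine ge_of_tendsto' hlim fun n => ?_
    have h1 := hφconv.add_inner_le_of_hasGradientAt (hφgrad (p + z)) (x n)
    have h2 := hgap' (x n)
    have h3 := hxμ n
    have h4 : ⟪φ' p, x n - p⟫ = ⟪φ' p, x n - (p + z)⟫ + ⟪φ' p, z⟫ := by
      rw [← inner_add_right]; congr 1; abel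
    rw [inner_sub_left]
    have := sq_nonneg ‖A (x n) - A p‖
    linarith
  have hφ'z : φ' (p + z) = φ' p := by
    have hmin : IsLocalMin (fun y => φ y - ⟪φ' p, y⟫) (p + z) := by
      refine Eventually.of_forall fun y => ?_
      have := hgap y
      rw [inner_sub_right] at this
      simp only [inner_add_right]
      linarith
    have hder := (hφgrad (p + z)).hasFDerivAt.sub
      (InnerProductSpace.toDual ℝ H (φ' p)).hasFDerivAt
    have h0 := hmin.hasFDerivAt_eq_zero hder
    exact (InnerProductSpace.toDual ℝ H).injective (sub_eq_zero.1 h0)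
  have hAz : A p = A (p + z) := by
    refine hAmax _ _ fun v => ?_
    have hsq : Tendsto (fun n => ‖A (x n) - A p‖) F (𝓝 0) := by
      have h1 : Tendsto (fun n => ‖A (x n) - A p‖ ^ 2) F (𝓝 0) := by
        refine tendsto_of_tendsto_of_tendsto_of_le_of_le tendsto_const_nhds hone
          (fun n => sq_nonneg _) fun n => ?_
        have h2 := hgap' (x n)
        have h3 := hgap (x n)
        have h4 := hxμ n
        show _ ≤ _
        linarith
      simpa [Real.sqrt_sq] using h1.sqrt
    have hlim : Tendsto (fun n => ⟪A v - A p, v - (p + z)⟫ - ⟪A v - A p, x n - (p + z)⟫ +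
        ‖A (x n) - A p‖ * (R + ‖v - p‖)) F (𝓝 ⟪A v - A p, v - (p + z)⟫) := by
      simpa using ((hconv (A v - A p)).const_sub _).add (hsq.mul_const (R + ‖v - p‖))
    refine ge_of_tendsto' hlim fun n => ?_
    have h1 := hAmono v (x n)
    have h2 : ⟪A v - A (x n), v - x n⟫ = ⟪A v - A p, v - (p + z)⟫ -
        ⟪A v - A p, x n - (p + z)⟫ - ⟪A (x n) - A p, v - x n⟫ := by
      rw [← inner_sub_right, sub_sub_sub_cancel_right, ← inner_sub_left,
        sub_sub_sub_cancel_right]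
    have h3 : ‖v - x n‖ ≤ R + ‖v - p‖ := by
      have := norm_sub_le_norm_sub_add_norm_sub v p (x n)
      rw [norm_sub_rev p] at this
      linarith [hxR n]
    have h4 := neg_le_of_abs_le (abs_real_inner_le_norm (A (x n) - A p) (v - x n))
    have h5 := mul_le_mul_of_nonneg_left h3 (norm_nonneg (A (x n) - A p))
    linarith
  have h1 := hVI (p + z) (by rw [hφ'z, ← hAz, hp])
  rw [add_sub_cancel_left] at h1
  have h2 := le_of_tendsto' (hz k) fun n => (hxd n).le
  linarith

/-- The derivative of the energy along a solution of
`u'' + γ u' + φ'(u) + A(u) + e Θ'(u) = 0`, centred at a zero `p` of `φ' + A`. -/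
theorem hasDerivAt_energy {H : Type*} [NormedAddCommGroup H] [InnerProductSpace ℝ H]
    [CompleteSpace H] {φ : H → ℝ} {φ' A Θ' : H → H} {u u' : ℝ → H} {w p : H} {γ e t : ℝ} (c : ℝ)
    (hφgrad : HasGradientAt φ (φ' (u t)) (u t)) (hp : φ' p + A p = 0)
    (hu : HasDerivAt u (u' t) t) (hu' : HasDerivAt u' w t)
    (heq : w + γ • u' t + φ' (u t) + A (u t) + e • Θ' (u t) = 0) :
    HasDerivAt (fun t => ⟪u' t, u t - p⟫ + γ / 2 * ‖u t - p‖ ^ 2 +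
        c * (‖u' t‖ ^ 2 / 2 + (φ (u t) - φ p - ⟪φ' p, u t - p⟫)))
      (‖u' t‖ ^ 2 - ⟪φ' (u t) - φ' p, u t - p⟫ - ⟪A (u t) - A p, u t - p⟫ -
        e * ⟪Θ' (u t), u t - p⟫ -
        c * (γ * ‖u' t‖ ^ 2 + ⟪A (u t) - A p, u' t⟫ + e * ⟪Θ' (u t), u' t⟫)) t := by
  have hφu : HasDerivAt (fun t => φ (u t)) ⟪φ' (u t), u' t⟫ t := by
    simpa [Function.comp_def] using hφgrad.hasFDerivAt.comp_hasDerivAt t hu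
  have hup := hu.sub_const p
  have hw : w = -(γ • u' t) - (φ' (u t) - φ' p) - (A (u t) - A p) - e • Θ' (u t) := by
    rw [← sub_eq_zero, ← heq, ← sub_eq_zero, ← neg_eq_zero, ← hp]
    abel
  have h := ((hu'.inner ℝ hup).add (hup.norm_sq.const_mul (γ / 2))).add
    (((hu'.norm_sq.div_const 2).add ((hφu.sub_const (φ p)).sub
      ((hasDerivAt_const t (φ' p)).inner ℝ hup))).const_mul c)
  refine h.congr_deriv ?_
  rw [real_inner_comm w (u' t), hw]
  simp only [inner_sub_left, inner_sub_right, inner_neg_left, real_inner_smul_left,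
    real_inner_self_eq_norm_sq, inner_zero_left, real_inner_comm (u t) (u' t),
    real_inner_comm p (u' t)]
  ring

/-- (Main Tikhonov theorem.)  Under `λγ² > 1`, `ε` decreasing to `0` with
`∫₀^∞ ε = ∞`, every solution of `ü + γu̇ + ∇φ(u) + A(u) + ε(t)∇Θ(u) = 0` converges strongly to
`u_*`, the unique solution of the variational inequality `u_* ∈ S`,
`⟪∇Θ(u_*), v − u_*⟫ ≥ 0 ∀ v ∈ S`. -/
theorem tikhonov_dynamic_strong_convergence
    {H : Type*} [NormedAddCommGroup H] [InnerProductSpace ℝ H] [CompleteSpace H]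
    (φ : H → ℝ) (φ' : H → H) (A : H → H) (lam γ : ℝ)
    (Θ : H → ℝ) (Θ' : H → H) (δ η : ℝ) (ε : ℝ → ℝ)
    (hφconv : ConvexOn ℝ univ φ)
    (hφgrad : ∀ x, HasGradientAt φ (φ' x) x)
    (hφlip : ∀ s : Set H, IsBounded s → ∃ K : ℝ≥0, LipschitzOnWith K φ' s)
    (hAmono : ∀ v w : H, 0 ≤ ⟪A v - A w, v - w⟫)
    (hAmax : ∀ x y : H, (∀ v : H, 0 ≤ ⟪A v - y, v - x⟫) → y = A x)
    (hlam : 0 < lam)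
    (hAcoco : ∀ v w : H, lam * ‖A v - A w‖ ^ 2 ≤ ⟪A v - A w, v - w⟫)
    (hγ : 0 < γ) (hcond : 1 < lam * γ ^ 2)
    (hΘconv : ConvexOn ℝ univ Θ) (hΘbdd : BddBelow (range Θ))
    (hΘgrad : ∀ x, HasGradientAt Θ (Θ' x) x)
    (hδ : 0 < δ) (hΘlip : ∀ x y : H, ‖Θ' x - Θ' y‖ ≤ δ * ‖x - y‖)
    (hη : 0 < η) (hΘsm : ∀ x y : H, η * ‖x - y‖ ^ 2 ≤ ⟪Θ' x - Θ' y, x - y⟫)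
    (hεC1 : ContDiffOn ℝ 1 ε (Ici 0)) (hεpos : ∀ t ∈ Ici (0:ℝ), 0 < ε t)
    (hεdec : AntitoneOn ε (Ici 0)) (hεlim : Tendsto ε atTop (𝓝 0))
    (S : Set H) (hS : S = {v : H | φ' v + A v = 0}) (hSne : S.Nonempty)
    (u u' u'' : ℝ → H)
    (hu : ∀ t ∈ Ici (0:ℝ), HasDerivWithinAt u (u' t) (Ici 0) t)
    (hu' : ∀ t ∈ Ici (0:ℝ), HasDerivWithinAt u' (u'' t) (Ici 0) t)
    (hu''cont : ContinuousOn u'' (Ici 0))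
    (heq : ∀ t ∈ Ici (0:ℝ), u'' t + γ • u' t + φ' (u t) + A (u t) + ε t • Θ' (u t) = 0)
    (hεdiv : (∫⁻ t in Ici (0:ℝ), ENNReal.ofReal (ε t)) = ∞)
    (u₀ v₀ : H) (hu0 : u 0 = u₀) (hv0 : u' 0 = v₀)
    (ustar : H) (hustarS : ustar ∈ S) (hustarVI : ∀ v ∈ S, 0 ≤ ⟪Θ' ustar, v - ustar⟫) :
    Tendsto u atTop (𝓝 ustar) := by
  subst hS
  have hp : φ' ustar + A ustar = 0 := hustarS
  obtain ⟨α, μ, C, e₀, hα, hμ, hC, he₀, hest⟩ :=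
    exists_dissipation_estimate (M := ‖Θ' ustar‖) hγ hlam hcond hδ hη
  obtain ⟨G, hG, hGmono, hGlim⟩ := exists_hasDerivAt_tendsto_atTop hεC1.continuousOn hεpos hεdiv
  let F : ℝ → ℝ := fun t => φ (u t) - φ ustar - ⟪φ' ustar, u t - ustar⟫
  let W : ℝ → ℝ := fun t => ⟪u' t, u t - ustar⟫ + γ / 2 * ‖u t - ustar‖ ^ 2 +
    2 * lam * γ * (‖u' t‖ ^ 2 / 2 + F t)
  let D : ℝ → ℝ := fun t =>
    ‖A (u t) - A ustar‖ ^ 2 + ⟪φ' (u t) - φ' ustar, u t - ustar⟫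
  let g : ℝ → ℝ := fun t => ⟪Θ' ustar, u t - ustar⟫
  have hF0 : ∀ t, 0 ≤ F t := fun t => by
    have := hφconv.add_inner_le_of_hasGradientAt (hφgrad ustar) (u t)
    simp only [F]
    linarith
  have hFq : ∀ t, F t ≤ ⟪φ' (u t) - φ' ustar, u t - ustar⟫ := fun t => by
    have := hφconv.add_inner_le_of_hasGradientAt (hφgrad (u t)) ustar
    rw [← neg_sub (u t) ustar, inner_neg_right] at this
    simp only [F, inner_sub_left]
    linarith
  have hD0 : ∀ t, 0 ≤ D t := fun t => add_nonneg (sq_nonneg _) ((hF0 t).trans (hFq t))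
  have hWlow : ∀ t, γ / 4 * ‖u t - ustar‖ ^ 2 ≤ W t := fun t => by
    have h1 := neg_le_of_abs_le (abs_real_inner_le_norm (u' t) (u t - ustar))
    have h2 : 0 ≤ 2 * lam * γ * F t := mul_nonneg (by positivity) (hF0 t)
    have h3 : ‖u' t‖ * ‖u t - ustar‖ ≤
        γ / 4 * ‖u t - ustar‖ ^ 2 + lam * γ * ‖u' t‖ ^ 2 := by
      have h4 : γ * (‖u' t‖ * ‖u t - ustar‖) ≤
          γ * (γ / 4 * ‖u t - ustar‖ ^ 2 + lam * γ * ‖u' t‖ ^ 2) := by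
        nlinarith [sq_nonneg (γ / 2 * ‖u t - ustar‖ - ‖u' t‖),
          mul_le_mul_of_nonneg_right hcond.le (sq_nonneg ‖u' t‖)]
      exact le_of_mul_le_mul_left h4 hγ
    simp only [W]
    linarith
  obtain ⟨W', hW', hW'le⟩ : ∃ W' : ℝ → ℝ, (∀ t, 0 < t → HasDerivAt W (W' t) t) ∧
      ∀ t, 0 < t → ε t ≤ e₀ →
        W' t ≤ ε t * (C * ε t - g t - α * W t) - μ * D t := by
    refine ⟨_, fun t ht => hasDerivAt_energy (2 * lam * γ) (hφgrad (u t)) hp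
      ((hu t ht.le).hasDerivAt (Ici_mem_nhds ht)) ((hu' t ht.le).hasDerivAt (Ici_mem_nhds ht))
      (heq t ht.le), fun t ht hte => ?_⟩
    refine hest (y := ‖u' t‖) (hεpos t ht.le) hte (hF0 t) (hFq t) ?_ (hAcoco _ _) ?_ ?_ ?_
    · exact (real_inner_le_norm _ _).trans_eq (mul_comm _ _)
    · have := hΘsm (u t) ustar
      rw [inner_sub_left] at this
      simp only [g]
      linarith
    · exact neg_le_of_abs_le (abs_real_inner_le_norm _ _)
    · refine (neg_le_neg ?_).trans (neg_le_of_abs_le (abs_real_inner_le_norm _ _))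
      have h1 := norm_le_norm_add_norm_sub' (Θ' (u t)) (Θ' ustar)
      gcongr
      linarith [hΘlip (u t) ustar]
  -- Boundedness of the energy, hence of the trajectory.
  obtain ⟨T, hT⟩ : ∃ T, ∀ t, T ≤ t → 0 < t ∧ ε t ≤ e₀ :=
    eventually_atTop.1 ((eventually_gt_atTop 0).and (hεlim.eventually_le_const he₀))
  have hglow : ∀ t, -g t ≤ α / 2 * W t + 2 * ‖Θ' ustar‖ ^ 2 / (α * γ) := fun t => by
    have h1 := neg_le_of_abs_le (abs_real_inner_le_norm (Θ' ustar) (u t - ustar))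
    have h2 := mul_le_mul_of_nonneg_left (hWlow t) (half_pos hα).le
    have h3 : α / 2 * (γ / 4 * ‖u t - ustar‖ ^ 2) + 2 * ‖Θ' ustar‖ ^ 2 / (α * γ) -
        ‖Θ' ustar‖ * ‖u t - ustar‖ =
        (α * γ * ‖u t - ustar‖ - 4 * ‖Θ' ustar‖) ^ 2 / (8 * (α * γ)) := by
      field_simp; ring
    have h4 : 0 ≤ (α * γ * ‖u t - ustar‖ - 4 * ‖Θ' ustar‖) ^ 2 / (8 * (α * γ)) := by
      positivity
    simp only [g]
    linarith
  obtain ⟨B, hB⟩ : ∃ B, ∀ t, T ≤ t → W t ≤ B := by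
    let a := C * e₀ + 2 * ‖Θ' ustar‖ ^ 2 / (α * γ)
    refine ⟨a / (α / 2) + |W T - a / (α / 2)|, fun t ht => ?_⟩
    refine (le_add_mul_exp_of_hasDerivAt_le (half_pos hα) (fun s hs => hG s (hT s hs).1)
      (fun s hs => hW' s (hT s hs).1) (a := a) (fun s hs => ?_) ht).trans ?_
    · have h1 := hW'le s (hT s hs).1 (hT s hs).2
      have h2 := mul_nonneg hμ.le (hD0 s)
      have h3 : ε s * (C * ε s - g s - α * W s) ≤ ε s * (a - α / 2 * W s) := by
        refine mul_le_mul_of_nonneg_left ?_ (hεpos s (hT s hs).1.le).le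
        have := mul_le_mul_of_nonneg_left (hT s hs).2 hC
        simp only [a]
        linarith [hglow s]
      linarith
    · gcongr
      refine (mul_le_mul_of_nonneg_right (le_abs_self _) (Real.exp_pos _).le).trans
        (mul_le_of_le_one_right (abs_nonneg _) (Real.exp_le_one_iff.2 ?_))
      have := mul_nonneg (half_pos hα).le (sub_nonneg.2 (hGmono ht))
      linarith
  -- Once `ε` is small, either the residual dominates or the variational inequality applies.
  have hWlim : ∀ d : ℝ, 0 < d → ∀ᶠ t in atTop, W t < d := by
    intro d hd
    let R := √(4 * B / γ)
    have hR : ∀ t, T ≤ t → ‖u t - ustar‖ ≤ R := fun t ht => by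
      refine Real.le_sqrt_of_sq_le ((le_div_iff₀ hγ).2 ?_)
      linarith [hWlow t, hB t ht]
    let d' := α * d / 4
    have hd' : 0 < d' := by positivity
    obtain ⟨ν, hν, hνle⟩ := exists_neg_le_inner_of_residual_le hφconv hφgrad hAmono hAmax hp
      hustarVI R hd'
    have hεC : Tendsto (fun t => C * ε t) atTop (𝓝 0) := by simpa using hεlim.const_mul C
    have hεR : Tendsto (fun t => ε t * (‖Θ' ustar‖ * R)) atTop (𝓝 0) := by
      simpa using hεlim.mul_const (‖Θ' ustar‖ * R)
    obtain ⟨T', hT'⟩ := eventually_atTop.1 ((eventually_ge_atTop T).and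
      ((hεC.eventually_le_const hd').and
        (hεR.eventually_le_const (mul_pos hμ hν))))
    have hW'le' : ∀ t, T' ≤ t → W' t ≤ ε t * (2 * d' - α * W t) := by
      intro t ht
      obtain ⟨htT, ht1, ht2⟩ := hT' t ht
      have hε := hεpos t (hT t htT).1.le
      have h1 := hW'le t (hT t htT).1 (hT t htT).2
      have h2 := mul_le_mul_of_nonneg_left ht1 hε.le
      suffices ε t * -g t ≤ ε t * d' + μ * D t by linarith
      rcases le_total (D t) ν with h | h
      · have h3 := mul_le_mul_of_nonneg_left (neg_le.1 (hνle (u t) (hR t htT) h)) hε.le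
        linarith [mul_nonneg hμ.le (hD0 t)]
      · have h3 : -g t ≤ ‖Θ' ustar‖ * R :=
          ((neg_le_abs _).trans (abs_real_inner_le_norm _ _)).trans
            (mul_le_mul_of_nonneg_left (hR t htT) (norm_nonneg _))
        have h4 := mul_le_mul_of_nonneg_left h3 hε.le
        have h5 := mul_le_mul_of_nonneg_left h hμ.le
        linarith [mul_pos hε hd']
    have hT'pos : ∀ t, T' ≤ t → 0 < t := fun t ht => (hT t (hT' t ht).1).1
    have hexp : Tendsto (fun t => 2 * d' / α + (W T' - 2 * d' / α) *
        Real.exp (-(α * (G t - G T')))) atTop (𝓝 (2 * d' / α + (W T' - 2 * d' / α) * 0)) := by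
      refine ((Real.tendsto_exp_neg_atTop_nhds_zero.comp
        (Tendsto.const_mul_atTop hα ?_)).const_mul _).const_add _
      exact tendsto_atTop_add_const_right _ _ hGlim
    have hlt : 2 * d' / α + (W T' - 2 * d' / α) * 0 < d := by
      have : 2 * d' / α = d / 2 := by simp only [d']; field_simp; ring
      linarith
    filter_upwards [hexp.eventually_lt_const hlt, eventually_ge_atTop T'] with t ht htT'
    exact (le_add_mul_exp_of_hasDerivAt_le hα (fun s hs => hG s (hT'pos s hs))
      (fun s hs => hW' s (hT'pos s hs)) hW'le' htT').trans_lt ht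
  rw [Metric.tendsto_nhds]
  intro r hr
  filter_upwards [hWlim (γ / 4 * r ^ 2) (by positivity)] with t ht
  rw [dist_eq_norm]
  have h1 := lt_of_mul_lt_mul_left ((hWlow t).trans_lt ht) (by positivity)
  exact lt_of_pow_lt_pow_left₀ 2 hr.le h1
end

section
/- Let H be a real Hilbert space, φ : H → ℝ a convex differentiable function whose gradient ∇φ is Lipschitz continuous on bounded sets, A : H → H a maximal monotone λ-cocoercive operator (λ > 0), γ > 0 with λγ² > 1, and S := (∇φ + A)⁻¹(0) nonempty. Let ε : [0,∞) → (0,∞) be a C¹ decreasing function with ε(t) → 0 as t → +∞ and ∫₀^∞ ε(s) ds = ∞. Then for any u₀, v₀ ∈ H, the unique solution u ∈ C²([0,∞); H) of ü(t) + γ u̇(t) + ∇φ(u(t)) + A(u(t)) + ε(t) u(t) = 0 with u(0) = u₀, u̇(0) = v₀ converges strongly in H, as t → +∞, to the element of minimal norm of the closed convex set S. -/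
open Filter MeasureTheory Set Bornology
open scoped RealInnerProductSpace NNReal Topology ENNReal

section ConvexGradient

variable {H : Type*} [NormedAddCommGroup H] [InnerProductSpace ℝ H]

theorem ConvexOn.add_inner_gradient_le [CompleteSpace H] {φ : H → ℝ} (hφ : ConvexOn ℝ univ φ)
    {x g : H} (hg : HasGradientAt φ g x) (y : H) : φ x + ⟪g, y - x⟫ ≤ φ y := by
  have hline : HasDerivAt (fun t : ℝ => AffineMap.lineMap x y t) (y - x) (0 : ℝ) := by
    simpa using AffineMap.hasDerivAt_lineMap (a := x) (b := y) (x := (0 : ℝ))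
  have hg' : HasFDerivAt φ (InnerProductSpace.toDual ℝ H g)
      (AffineMap.lineMap x y (0 : ℝ)) := by
    simpa using hg.hasFDerivAt
  have hder : HasDerivAt (φ ∘ fun t : ℝ => AffineMap.lineMap x y t) ⟪g, y - x⟫ (0 : ℝ) :=
    hg'.comp_hasDerivAt (0 : ℝ) hline
  have hconv : ConvexOn ℝ univ (φ ∘ fun t : ℝ => AffineMap.lineMap x y t) :=
    hφ.comp_affineMap (AffineMap.lineMap x y)
  have h := hconv.le_slope_of_hasDerivAt (mem_univ 0) (mem_univ 1) one_pos hder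
  simp [slope_def_field] at h
  linarith

theorem gradient_add_eq_zero_iff [CompleteSpace H] {φ : H → ℝ} {φ' A : H → H} {lam : ℝ}
    (hφ : ConvexOn ℝ univ φ) (hgrad : ∀ x, HasGradientAt φ (φ' x) x)
    (hAmax : ∀ x y : H, (∀ v : H, 0 ≤ ⟪A v - y, v - x⟫) → y = A x) (hlam : 0 < lam)
    (hA : ∀ v w : H, lam * ‖A v - A w‖ ^ 2 ≤ ⟪A v - A w, v - w⟫)
    {p : H} (hp : φ' p + A p = 0) (x : H) :
    φ' x + A x = 0 ↔
      φ x ≤ φ p + ⟪φ' p, x - p⟫ ∧ ∀ y, 0 ≤ ⟪A y - A p, y - x⟫ := by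
  constructor
  · intro hx
    have h₁ := hφ.add_inner_gradient_le (hgrad x) p
    have h₂ := hφ.add_inner_gradient_le (hgrad p) x
    have h₃ := hA x p
    have hφx : φ' x = - A x := eq_neg_of_add_eq_zero_left hx
    have hφp : φ' p = - A p := eq_neg_of_add_eq_zero_left hp
    have hsum : ⟪A x - A p, x - p⟫ = ⟪φ' x, p - x⟫ + ⟪φ' p, x - p⟫ := by
      rw [hφx, hφp, ← neg_sub x p, inner_neg_right, inner_neg_left, inner_neg_left,
        inner_sub_left]
      ring
    have hnn : 0 ≤ lam * ‖A x - A p‖ ^ 2 := by positivity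
    have hzero : lam * ‖A x - A p‖ ^ 2 = 0 := by linarith
    have hAx : A x = A p := by
      have : ‖A x - A p‖ ^ 2 = 0 := by
        rcases mul_eq_zero.1 hzero with h | h
        · exact absurd h hlam.ne'
        · exact h
      exact sub_eq_zero.1 (norm_eq_zero.1 (pow_eq_zero_iff two_ne_zero |>.1 this))
    refine ⟨by linarith, fun y => ?_⟩
    rw [← hAx]
    exact le_trans (by positivity) (hA y x)
  · rintro ⟨hle, hmono⟩
    have hAx : A p = A x := hAmax x (A p) hmono
    have hmin : IsLocalMin (fun y => φ y - InnerProductSpace.toDual ℝ H (φ' p) y) x := by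
      refine Filter.Eventually.of_forall fun y => ?_
      have h := hφ.add_inner_gradient_le (hgrad p) y
      simp only [InnerProductSpace.toDual_apply_apply]
      rw [inner_sub_right] at h hle
      linarith
    have h := hmin.hasFDerivAt_eq_zero
      ((hgrad x).hasFDerivAt.sub (InnerProductSpace.toDual ℝ H (φ' p)).hasFDerivAt)
    rw [sub_eq_zero] at h
    rw [(InnerProductSpace.toDual ℝ H).injective h, ← hAx, hp]

theorem exists_forall_inner_nonneg_of_gradient_add_eq_zero [CompleteSpace H]
    {φ : H → ℝ} {φ' A : H → H} {lam : ℝ}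
    (hφ : ConvexOn ℝ univ φ) (hgrad : ∀ x, HasGradientAt φ (φ' x) x)
    (hAmax : ∀ x y : H, (∀ v : H, 0 ≤ ⟪A v - y, v - x⟫) → y = A x) (hlam : 0 < lam)
    (hA : ∀ v w : H, lam * ‖A v - A w‖ ^ 2 ≤ ⟪A v - A w, v - w⟫)
    (hne : {v : H | φ' v + A v = 0}.Nonempty) :
    ∃ p, φ' p + A p = 0 ∧ ∀ v, φ' v + A v = 0 → 0 ≤ ⟪p, v - p⟫ := by
  obtain ⟨z, hz⟩ := hne
  have hset : {v : H | φ' v + A v = 0} =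
      {x | φ x - InnerProductSpace.toDual ℝ H (φ' z) x ≤ φ z - ⟪φ' z, z⟫} ∩
        ⋂ y, {x | InnerProductSpace.toDual ℝ H (A y - A z) x ≤ ⟪A y - A z, y⟫} := by
    ext x
    simp only [mem_ofPred_eq, mem_inter_iff, mem_iInter, InnerProductSpace.toDual_apply_apply,
      gradient_add_eq_zero_iff hφ hgrad hAmax hlam hA hz x, inner_sub_right, sub_nonneg]
    refine and_congr_left fun _ => ?_
    constructor <;> intro h <;> linarith
  have hcont : Continuous φ :=
    continuous_iff_continuousAt.2 fun x => (hgrad x).hasFDerivAt.continuousAt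
  have hclosed : IsClosed {v : H | φ' v + A v = 0} := by
    rw [hset]
    refine IsClosed.inter (isClosed_le (by fun_prop) continuous_const)
      (isClosed_iInter fun y => isClosed_le (by fun_prop) continuous_const)
  have hconvex : Convex ℝ {v : H | φ' v + A v = 0} := by
    rw [hset]
    refine Convex.inter ?_ (convex_iInter fun y => ?_)
    · have h := (hφ.sub ((InnerProductSpace.toDual ℝ H (φ' z)).toLinearMap.concaveOn
        convex_univ)).convex_le (φ z - ⟪φ' z, z⟫)
      simpa using h
    · exact convex_halfSpace_le (InnerProductSpace.toDual ℝ H (A y - A z)).isLinear _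
  obtain ⟨p, hp, hmin⟩ :=
    exists_norm_eq_iInf_of_complete_convex ⟨z, hz⟩ hclosed.isComplete hconvex 0
  refine ⟨p, hp, fun v hv => ?_⟩
  have h := (norm_eq_iInf_iff_real_inner_le_zero hconvex hp).1 hmin v hv
  rw [zero_sub, inner_neg_left] at h
  linarith

theorem exists_tendsto_inner_of_norm_le [CompleteSpace H] {ι : Type*} (l : Ultrafilter ι)
    {x : ι → H} {R : ℝ} (hx : ∀ i, ‖x i‖ ≤ R) :
    ∃ y, ∀ z, Tendsto (fun i => ⟪x i, z⟫) l (𝓝 ⟪y, z⟫) := by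
  let f : ι → WeakDual ℝ H := fun i => StrongDual.toWeakDual (InnerProductSpace.toDual ℝ H (x i))
  have hmem : ∀ i, f i ∈ WeakDual.toStrongDual ⁻¹'
      Metric.closedBall (0 : StrongDual ℝ H) R := by
    intro i
    rw [mem_preimage, mem_closedBall_zero_iff]
    exact ((InnerProductSpace.toDual ℝ H).norm_map (x i)).le.trans (hx i)
  obtain ⟨d, -, hd⟩ := (WeakDual.isCompact_closedBall (𝕜 := ℝ) (0 : StrongDual ℝ H) R)
    |>.ultrafilter_le_nhds' (l.map f) (Filter.mem_map.2 (Filter.univ_mem' hmem))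
  refine ⟨(InnerProductSpace.toDual ℝ H).symm (WeakDual.toStrongDual d), fun z => ?_⟩
  rw [InnerProductSpace.toDual_symm_apply]
  have hf : Tendsto f l (𝓝 d) := hd
  exact ((WeakDual.eval_continuous z).tendsto d).comp hf

theorem exists_pos_forall_neg_inner_le [CompleteSpace H]
    {φ : H → ℝ} {φ' A : H → H} {lam : ℝ}
    (hφ : ConvexOn ℝ univ φ) (hgrad : ∀ x, HasGradientAt φ (φ' x) x)
    (hAmax : ∀ x y : H, (∀ v : H, 0 ≤ ⟪A v - y, v - x⟫) → y = A x) (hlam : 0 < lam)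
    (hA : ∀ v w : H, lam * ‖A v - A w‖ ^ 2 ≤ ⟪A v - A w, v - w⟫)
    {p : H} (hp : φ' p + A p = 0) (hpmin : ∀ v, φ' v + A v = 0 → 0 ≤ ⟪p, v - p⟫)
    (R : ℝ) {η : ℝ} (hη : 0 < η) :
    ∃ θ > 0, ∀ x, ‖x‖ ≤ R → ‖A x - A p‖ ^ 2 ≤ θ → φ x - φ p - ⟪φ' p, x - p⟫ ≤ θ →
      -⟪p, x - p⟫ ≤ η := by
  by_contra! hcon
  choose x hxR hxA hxφ hxη using fun n : ℕ =>
    hcon (1 / ((n : ℝ) + 1)) Nat.one_div_pos_of_nat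
  let l : Ultrafilter ℕ := hyperfilter ℕ
  have hl : (l : Filter ℕ) ≤ atTop := Nat.hyperfilter_le_atTop
  have hone : Tendsto (fun n : ℕ => 1 / ((n : ℝ) + 1)) l (𝓝 0) :=
    tendsto_one_div_add_atTop_nhds_zero_nat.mono_left hl
  obtain ⟨y, hy⟩ := exists_tendsto_inner_of_norm_le l hxR
  have hy' : ∀ c z, Tendsto (fun i => ⟪z, x i - c⟫) l (𝓝 ⟪z, y - c⟫) := fun c z => by
    simpa only [inner_sub_right, real_inner_comm] using (hy z).sub_const ⟪z, c⟫
  have hAlim : Tendsto (fun n => ‖A (x n) - A p‖) l (𝓝 0) := by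
    have h := (squeeze_zero (fun n => sq_nonneg ‖A (x n) - A p‖) hxA hone).sqrt
    simpa only [Real.sqrt_sq (norm_nonneg _), Real.sqrt_zero] using h
  have hyS : φ' y + A y = 0 := by
    refine (gradient_add_eq_zero_iff hφ hgrad hAmax hlam hA hp y).2 ⟨?_, fun z => ?_⟩
    · have hle : ∀ n, φ y + ⟪φ' y, x n - y⟫ ≤
          1 / ((n : ℝ) + 1) + (φ p + ⟪φ' p, x n - p⟫) := fun n => by
        have h₁ := hφ.add_inner_gradient_le (hgrad y) (x n)
        have h₂ := hxφ n
        linarith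
      have h := le_of_tendsto_of_tendsto' ((hy' y (φ' y)).const_add (φ y))
        (hone.add ((hy' p (φ' p)).const_add (φ p))) hle
      simpa using h
    · have hle : ∀ n, ⟪A z - A p, x n - z⟫ ≤ ‖A (x n) - A p‖ * (R + ‖z‖) := fun n => by
        have h₁ : 0 ≤ ⟪A (x n) - A z, x n - z⟫ := le_trans (by positivity) (hA (x n) z)
        have h₂ := real_inner_le_norm (A (x n) - A p) (x n - z)
        have h₃ : ‖x n - z‖ ≤ R + ‖z‖ := (norm_sub_le _ _).trans (by gcongr; exact hxR n)
        have h₄ := mul_le_mul_of_nonneg_left h₃ (norm_nonneg (A (x n) - A p))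
        rw [← sub_sub_sub_cancel_right _ _ (A p), inner_sub_left] at h₁
        linarith
      have h := le_of_tendsto_of_tendsto' (hy' z (A z - A p)) (hAlim.mul_const (R + ‖z‖)) hle
      rw [zero_mul, ← neg_sub z y, inner_neg_right] at h
      linarith
  have hlim := ge_of_tendsto' (hy' p p).neg fun n => (hxη n).le
  linarith [hpmin y hyS]

theorem tikhonov_dissipation_le {lam γ δ e P : ℝ} {p w v a q : H} (hδ : 0 < δ)
    (hγ : 0 < γ)
    (hquad : ∀ x y : ℝ, x * y ≤ (γ / 2 - δ) * x ^ 2 + (γ * lam / 2 - δ) * y ^ 2)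
    (hδγ : δ ≤ γ) (hP : 0 ≤ P) (hq : P ≤ ⟪q, w⟫) (ha : lam * ‖a‖ ^ 2 ≤ ⟪a, w⟫)
    (he : 0 ≤ e) (heδ : 4 * e ≤ γ * δ) :
    ⟪v, -(γ • v + q + a + e • (p + w))⟫ + ⟪q, v⟫ +
        γ / 2 * (⟪-(γ • v + q + a + e • (p + w)), w⟫ + ‖v‖ ^ 2) + γ ^ 2 / 2 * ⟪v, w⟫ ≤
      -(δ / 2) * (‖v‖ ^ 2 + ‖a‖ ^ 2 + P) - γ / 4 * e * ‖w‖ ^ 2 - γ / 2 * e * ⟪p, w⟫ +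
        e ^ 2 * ‖p‖ ^ 2 / δ := by
  have hexpand : ⟪v, -(γ • v + q + a + e • (p + w))⟫ + ⟪q, v⟫ +
        γ / 2 * (⟪-(γ • v + q + a + e • (p + w)), w⟫ + ‖v‖ ^ 2) + γ ^ 2 / 2 * ⟪v, w⟫ =
      -(γ / 2) * ‖v‖ ^ 2 - ⟪v, a⟫ - γ / 2 * (⟪q, w⟫ + ⟪a, w⟫) - e * ⟪v, p + w⟫ -
        γ / 2 * e * ⟪p, w⟫ - γ / 2 * e * ‖w‖ ^ 2 := by
    simp only [inner_neg_left, inner_neg_right, inner_add_left, inner_add_right,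
      real_inner_smul_left, real_inner_smul_right, real_inner_self_eq_norm_sq,
      real_inner_comm v q]
    ring
  have hva : -⟪v, a⟫ ≤ (γ / 2 - δ) * ‖v‖ ^ 2 + (γ * lam / 2 - δ) * ‖a‖ ^ 2 :=
    (neg_le_abs _).trans ((abs_real_inner_le_norm v a).trans (hquad _ _))
  have hpw : ‖p + w‖ ^ 2 ≤ 2 * ‖p‖ ^ 2 + 2 * ‖w‖ ^ 2 := by
    have h := parallelogram_law_with_norm ℝ p w
    nlinarith [sq_nonneg ‖p - w‖]
  have hcross : -(e * ⟪v, p + w⟫) ≤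
      δ / 2 * ‖v‖ ^ 2 + e ^ 2 * ‖p‖ ^ 2 / δ + e ^ 2 * ‖w‖ ^ 2 / δ := by
    have h₁ : -(e * ⟪v, p + w⟫) ≤ e * (‖v‖ * ‖p + w‖) := by
      rw [← mul_neg]
      exact mul_le_mul_of_nonneg_left
        ((neg_le_abs _).trans (abs_real_inner_le_norm v (p + w))) he
    have h₂ : e * (‖v‖ * ‖p + w‖) ≤ δ / 2 * ‖v‖ ^ 2 + e ^ 2 * ‖p + w‖ ^ 2 / (2 * δ) := by
      have h : δ / 2 * ‖v‖ ^ 2 + e ^ 2 * ‖p + w‖ ^ 2 / (2 * δ) - e * (‖v‖ * ‖p + w‖) =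
          (δ * ‖v‖ - e * ‖p + w‖) ^ 2 / (2 * δ) := by
        field_simp
        ring
      have h' : 0 ≤ (δ * ‖v‖ - e * ‖p + w‖) ^ 2 / (2 * δ) := by positivity
      linarith
    have h₃ : e ^ 2 * ‖p + w‖ ^ 2 / (2 * δ) ≤
        e ^ 2 * (2 * ‖p‖ ^ 2 + 2 * ‖w‖ ^ 2) / (2 * δ) := by gcongr
    have h₄ : e ^ 2 * (2 * ‖p‖ ^ 2 + 2 * ‖w‖ ^ 2) / (2 * δ) =
        e ^ 2 * ‖p‖ ^ 2 / δ + e ^ 2 * ‖w‖ ^ 2 / δ := by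
      field_simp
    linarith
  have hew : e ^ 2 * ‖w‖ ^ 2 / δ ≤ γ / 4 * e * ‖w‖ ^ 2 := by
    rw [div_le_iff₀ hδ]
    nlinarith [mul_le_mul_of_nonneg_right heδ (mul_nonneg he (sq_nonneg ‖w‖))]
  have hgq := mul_le_mul_of_nonneg_left hq hγ.le
  have hga := mul_le_mul_of_nonneg_left ha hγ.le
  have hδP := mul_le_mul_of_nonneg_right hδγ hP
  have hδa : 0 ≤ δ * ‖a‖ ^ 2 := by positivity
  rw [hexpand]
  linarith

theorem exists_pos_quadratic_le {lam γ : ℝ} (hlam : 0 < lam) (hγ : 0 < γ)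
    (hcond : 1 < lam * γ ^ 2) :
    ∃ δ > 0, δ ≤ γ ∧
      ∀ x y : ℝ, x * y ≤ (γ / 2 - δ) * x ^ 2 + (γ * lam / 2 - δ) * y ^ 2 := by
  obtain ⟨δ, hδ⟩ : ∃ δ, δ = (lam * γ ^ 2 - 1) / (2 * γ * (1 + lam)) := ⟨_, rfl⟩
  have hmul : δ * (2 * γ * (1 + lam)) = lam * γ ^ 2 - 1 := by
    rw [hδ, div_mul_cancel₀ _ (by positivity)]
  have hδpos : 0 < δ := by
    rw [hδ]
    exact div_pos (by linarith) (by positivity)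
  have hδγ : δ < γ / 2 := by
    rw [hδ, div_lt_iff₀ (by positivity)]
    nlinarith
  have hprod : 1 ≤ 4 * (γ / 2 - δ) * (γ * lam / 2 - δ) := by nlinarith [sq_nonneg δ]
  have hα : 0 < γ / 2 - δ := by linarith
  refine ⟨δ, hδpos, by linarith, fun x y => ?_⟩
  refine le_of_mul_le_mul_left ?_ hα
  nlinarith [sq_nonneg ((γ / 2 - δ) * x - y / 2),
    mul_le_mul_of_nonneg_right hprod (sq_nonneg y)]

end ConvexGradient

theorem tendsto_intervalIntegral_atTop_of_lintegral_eq_top {g : ℝ → ℝ} (hg : Continuous g)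
    (hpos : ∀ t, 0 ≤ g t) (a : ℝ) (hint : (∫⁻ t in Ici a, ENNReal.ofReal (g t)) = ∞) :
    Tendsto (fun t => ∫ s in a..t, g s) atTop atTop := by
  have hmono : Monotone fun t => ∫ s in a..t, g s := fun s t hst => by
    have h := intervalIntegral.integral_add_adjacent_intervals
      (hg.intervalIntegrable (μ := volume) a s) (hg.intervalIntegrable s t)
    have h' : 0 ≤ ∫ r in s..t, g r := intervalIntegral.integral_nonneg hst fun r _ => hpos r
    simp only
    linarith
  refine tendsto_atTop_atTop_of_monotone' hmono fun hbdd => ?_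
  obtain ⟨I, hI⟩ := hbdd
  have hint' : IntegrableOn g (Ioi a) := by
    refine integrableOn_Ioi_of_intervalIntegral_norm_bounded (b := id) (l := atTop) I a
      (fun i => ?_) tendsto_id (Filter.Eventually.of_forall fun t => ?_)
    · exact hg.integrableOn_Ioc
    · simp only [Real.norm_of_nonneg (hpos _)]
      exact hI ⟨t, rfl⟩
  have hfin := hint'.hasFiniteIntegral
  rw [hasFiniteIntegral_iff_ofReal (Filter.Eventually.of_forall hpos),
    setLIntegral_congr Ioi_ae_eq_Ici, hint] at hfin
  exact lt_irrefl _ hfin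

theorem eventually_le_add_of_hasDerivAt_le {g f f' : ℝ → ℝ} (hg : Continuous g) {a κ M : ℝ}
    (hG : Tendsto (fun t => ∫ s in a..t, g s) atTop atTop) (hκ : 0 < κ)
    (hf : ∀ᶠ t in atTop, HasDerivAt f (f' t) t)
    (hf' : ∀ᶠ t in atTop, f' t ≤ -κ * g t * (f t - M)) {η : ℝ} (hη : 0 < η) :
    ∀ᶠ t in atTop, f t ≤ M + η := by
  obtain ⟨T, hT⟩ := eventually_atTop.1 (hf.and hf')
  have hder : ∀ t ≥ T, HasDerivAt (fun t => (f t - M) * Real.exp (κ * ∫ s in a..t, g s))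
      (f' t * Real.exp (κ * ∫ s in a..t, g s) +
        (f t - M) * (Real.exp (κ * ∫ s in a..t, g s) * (κ * g t))) t := fun t ht =>
    ((hT t ht).1.sub_const M).mul ((hg.integral_hasStrictDerivAt a t).hasDerivAt.const_mul κ).exp
  have hanti : AntitoneOn (fun t => (f t - M) * Real.exp (κ * ∫ s in a..t, g s)) (Ici T) := by
    refine antitoneOn_of_deriv_nonpos (convex_Ici T)
      (fun t ht => (hder t ht).continuousAt.continuousWithinAt)
      (fun t ht => (hder t (interior_subset ht)).differentiableAt.differentiableWithinAt)
      fun t ht => ?_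
    rw [(hder t (interior_subset ht)).deriv]
    have h := mul_le_mul_of_nonneg_right (hT t (interior_subset ht)).2
      (Real.exp_pos (κ * ∫ s in a..t, g s)).le
    linarith
  have hexp : Tendsto (fun t => (f T - M) * Real.exp (κ * ∫ s in a..T, g s) *
      Real.exp (-(κ * ∫ s in a..t, g s))) atTop (𝓝 0) := by
    simpa using (Real.tendsto_exp_neg_atTop_nhds_zero.comp
      (hG.const_mul_atTop hκ)).const_mul ((f T - M) * Real.exp (κ * ∫ s in a..T, g s))
  filter_upwards [hexp.eventually_le_const hη, eventually_ge_atTop T] with t ht hTt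
  have h : (f t - M) * Real.exp (κ * ∫ s in a..t, g s) ≤
    (f T - M) * Real.exp (κ * ∫ s in a..T, g s) := hanti self_mem_Ici hTt hTt
  have h' := mul_le_mul_of_nonneg_right h (Real.exp_pos (-(κ * ∫ s in a..t, g s))).le
  rw [mul_assoc, ← Real.exp_add, add_neg_cancel, Real.exp_zero, mul_one] at h'
  linarith

/-- (Classical Tikhonov regularization.)  Under `λγ² > 1`, `ε` decreasing to
`0` with `∫₀^∞ ε = ∞`, every solution of `ü + γu̇ + ∇φ(u) + A(u) + ε(t)u = 0` converges
strongly to the element of minimal norm of `S = (∇φ + A)⁻¹(0)`. -/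
theorem tikhonov_dynamic_minimal_norm_convergence
    {H : Type*} [NormedAddCommGroup H] [InnerProductSpace ℝ H] [CompleteSpace H]
    (φ : H → ℝ) (φ' : H → H) (A : H → H) (lam γ : ℝ) (ε : ℝ → ℝ)
    (hφconv : ConvexOn ℝ univ φ)
    (hφgrad : ∀ x, HasGradientAt φ (φ' x) x)
    (hφlip : ∀ s : Set H, IsBounded s → ∃ K : ℝ≥0, LipschitzOnWith K φ' s)
    (hAmono : ∀ v w : H, 0 ≤ ⟪A v - A w, v - w⟫)
    (hAmax : ∀ x y : H, (∀ v : H, 0 ≤ ⟪A v - y, v - x⟫) → y = A x)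
    (hlam : 0 < lam)
    (hAcoco : ∀ v w : H, lam * ‖A v - A w‖ ^ 2 ≤ ⟪A v - A w, v - w⟫)
    (hγ : 0 < γ) (hcond : 1 < lam * γ ^ 2)
    (hεC1 : ContDiffOn ℝ 1 ε (Ici 0)) (hεpos : ∀ t ∈ Ici (0:ℝ), 0 < ε t)
    (hεdec : AntitoneOn ε (Ici 0)) (hεlim : Tendsto ε atTop (𝓝 0))
    (hεdiv : (∫⁻ t in Ici (0:ℝ), ENNReal.ofReal (ε t)) = ∞)
    (S : Set H) (hS : S = {v : H | φ' v + A v = 0}) (hSne : S.Nonempty)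
    (u₀ v₀ : H) (u u' u'' : ℝ → H)
    (hu0 : u 0 = u₀) (hv0 : u' 0 = v₀)
    (hu : ∀ t ∈ Ici (0:ℝ), HasDerivWithinAt u (u' t) (Ici 0) t)
    (hu' : ∀ t ∈ Ici (0:ℝ), HasDerivWithinAt u' (u'' t) (Ici 0) t)
    (hu''cont : ContinuousOn u'' (Ici 0))
    (heq : ∀ t ∈ Ici (0:ℝ), u'' t + γ • u' t + φ' (u t) + A (u t) + ε t • u t = 0) :
    ∃ ustar ∈ S, (∀ v ∈ S, ‖ustar‖ ≤ ‖v‖) ∧ Tendsto u atTop (𝓝 ustar) := by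
  subst hS
  obtain ⟨p, hp, hpmin⟩ :=
    exists_forall_inner_nonneg_of_gradient_add_eq_zero hφconv hφgrad hAmax hlam hAcoco hSne
  refine ⟨p, hp, fun v hv => ?_, ?_⟩
  · have h := hpmin v hv
    rw [inner_sub_right, real_inner_self_eq_norm_sq] at h
    have h' := real_inner_le_norm p v
    by_contra! hlt
    nlinarith [norm_nonneg v]
  obtain ⟨δ, hδ, hδγ, hquad⟩ := exists_pos_quadratic_le hlam hγ hcond
  obtain ⟨W, hW⟩ : ∃ W : ℝ → ℝ, W = fun t => 1 / 2 * ‖u' t‖ ^ 2 +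
      (φ (u t) - φ p - ⟪φ' p, u t - p⟫) + γ / 2 * ⟪u' t, u t - p⟫ +
      γ ^ 2 / 4 * ‖u t - p‖ ^ 2 := ⟨_, rfl⟩
  obtain ⟨W', hW'⟩ : ∃ W' : ℝ → ℝ, W' = fun t => ⟪u' t, u'' t⟫ + ⟪φ' (u t) - φ' p, u' t⟫ +
      γ / 2 * (⟪u'' t, u t - p⟫ + ‖u' t‖ ^ 2) + γ ^ 2 / 2 * ⟪u' t, u t - p⟫ := ⟨_, rfl⟩
  obtain ⟨P, hPdef⟩ : ∃ P : ℝ → ℝ, P = fun t => φ (u t) - φ p - ⟪φ' p, u t - p⟫ := ⟨_, rfl⟩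
  have hP : ∀ t, 0 ≤ P t := fun t => by
    have h := hφconv.add_inner_gradient_le (hφgrad p) (u t)
    rw [hPdef]
    linarith
  obtain ⟨D, hD⟩ : ∃ D : ℝ → ℝ,
      D = fun t => ‖u' t‖ ^ 2 + ‖A (u t) - A p‖ ^ 2 + P t := ⟨_, rfl⟩
  have hDnn : ∀ t, 0 ≤ D t := fun t => by
    rw [hD]
    exact add_nonneg (by positivity) (hP t)
  have hWder : ∀ t > 0, HasDerivAt W (W' t) t := fun t ht => by
    have hut : HasDerivAt u (u' t) t := (hu t ht.le).hasDerivAt (Ici_mem_nhds ht)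
    have hu't : HasDerivAt u' (u'' t) t := (hu' t ht.le).hasDerivAt (Ici_mem_nhds ht)
    have hφt : HasDerivAt (fun s => φ (u s)) ⟪φ' (u t), u' t⟫ t :=
      (hφgrad (u t)).hasFDerivAt.comp_hasDerivAt t hut
    have hwt : HasDerivAt (fun s => u s - p) (u' t) t := hut.sub_const p
    have h := ((((hu't.norm_sq).const_mul (1 / 2)).add
      ((hφt.sub_const (φ p)).sub ((hasDerivAt_const t (φ' p)).inner ℝ hwt))).add
      ((hu't.inner ℝ hwt).const_mul (γ / 2))).add ((hwt.norm_sq).const_mul (γ ^ 2 / 4))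
    rw [hW, hW']
    refine h.congr_deriv ?_
    simp only [inner_zero_left, inner_sub_left (φ' (u t)), real_inner_self_eq_norm_sq,
      real_inner_comm (u' t) (u t - p)]
    ring
  have hupper : ∀ t, W t ≤ D t + γ ^ 2 / 2 * ‖u t - p‖ ^ 2 := fun t => by
    have h := real_inner_le_norm (u' t) (u t - p)
    have h' := mul_le_mul_of_nonneg_left h hγ.le
    simp only [hW, hD, hPdef]
    nlinarith [sq_nonneg (‖u' t‖ - γ / 2 * ‖u t - p‖), sq_nonneg ‖A (u t) - A p‖]
  have hlower : ∀ t, γ ^ 2 / 8 * ‖u t - p‖ ^ 2 ≤ W t := fun t => by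
    have h := neg_le_of_abs_le (abs_real_inner_le_norm (u' t) (u t - p))
    have h' := mul_le_mul_of_nonneg_left h hγ.le
    have hPt := hP t
    simp only [hPdef] at hPt
    simp only [hW]
    nlinarith [sq_nonneg (‖u' t‖ - γ / 2 * ‖u t - p‖)]
  have hdiss : ∀ t > 0, 4 * ε t ≤ γ * δ → W' t ≤ -(δ / 2) * D t -
      γ / 4 * ε t * ‖u t - p‖ ^ 2 - γ / 2 * ε t * ⟪p, u t - p⟫ + ε t ^ 2 * ‖p‖ ^ 2 / δ := by
    intro t ht hε
    have hq : P t ≤ ⟪φ' (u t) - φ' p, u t - p⟫ := by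
      have h := hφconv.add_inner_gradient_le (hφgrad (u t)) p
      rw [← neg_sub (u t) p, inner_neg_right] at h
      rw [hPdef, inner_sub_left]
      linarith
    have hacc : u'' t = -(γ • u' t + (φ' (u t) - φ' p) + (A (u t) - A p) +
        ε t • (p + (u t - p))) := by
      rw [add_sub_cancel, eq_neg_iff_add_eq_zero]
      calc _ = (u'' t + γ • u' t + φ' (u t) + A (u t) + ε t • u t) - (φ' p + A p) := by abel
        _ = 0 := by rw [heq t ht.le, hp, sub_zero]
    have h := tikhonov_dissipation_le (p := p) (v := u' t) hδ hγ hquad hδγ (hP t) hq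
      (hAcoco (u t) p) (hεpos t ht.le).le hε
    rw [← hacc] at h
    simp only [hW', hD]
    exact h
  obtain ⟨g, hg, hgε, hG⟩ : ∃ g : ℝ → ℝ, Continuous g ∧ (∀ t ≥ 0, g t = ε t) ∧
      Tendsto (fun t => ∫ s in (0 : ℝ)..t, g s) atTop atTop := by
    have hgε : ∀ t ≥ 0, ε (max t 0) = ε t := fun t ht => by rw [max_eq_left ht]
    have hg : Continuous fun t => ε (max t 0) :=
      hεC1.continuousOn.comp_continuous (by fun_prop) fun t => le_max_right t 0
    refine ⟨_, hg, hgε, tendsto_intervalIntegral_atTop_of_lintegral_eq_top hg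
      (fun t => (hεpos _ (le_max_right t 0)).le) 0 ?_⟩
    rw [← hεdiv]
    exact setLIntegral_congr_fun measurableSet_Ici fun t ht => by simp only [hgε t ht]
  obtain ⟨κ, hκ, hκδ, hκγ⟩ : ∃ κ > 0, κ ≤ δ / 4 ∧ κ * γ ≤ 1 / 4 := by
    refine ⟨min (δ / 4) (1 / (4 * γ)), by positivity, min_le_left _ _, ?_⟩
    refine (mul_le_mul_of_nonneg_right (min_le_right _ _) hγ.le).trans (le_of_eq ?_)
    field_simp
  have hκW : ∀ t ≥ 0, ε t ≤ 1 →
      κ * ε t * W t ≤ δ / 4 * D t + γ / 8 * ε t * ‖u t - p‖ ^ 2 := fun t ht hε1 => by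
    have he := (hεpos t ht).le
    have h₁ : κ * ε t * W t ≤ κ * ε t * (D t + γ ^ 2 / 2 * ‖u t - p‖ ^ 2) :=
      mul_le_mul_of_nonneg_left (hupper t) (by positivity)
    have h₂ : κ * ε t * D t ≤ δ / 4 * D t := by
      refine mul_le_mul_of_nonneg_right ?_ (hDnn t)
      nlinarith
    have h₃ : κ * γ * (γ / 2 * (ε t * ‖u t - p‖ ^ 2)) ≤
        1 / 4 * (γ / 2 * (ε t * ‖u t - p‖ ^ 2)) :=
      mul_le_mul_of_nonneg_right hκγ (by positivity)
    linarith
  have hsmall : ∀ c > 0, ∀ᶠ t in atTop, ε t ≤ c := fun c hc => hεlim.eventually_le_const hc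
  have hder : ∀ᶠ t in atTop, HasDerivAt W (W' t) t :=
    (eventually_gt_atTop 0).mono hWder
  have hsq : ∀ c > 0, ∀ᶠ t in atTop, ε t ^ 2 * ‖p‖ ^ 2 / δ ≤ c * ε t := fun c hc => by
    filter_upwards [hsmall (c * δ / (‖p‖ ^ 2 + 1)) (by positivity), eventually_gt_atTop 0]
      with t ht ht0
    have he := hεpos t ht0.le
    rw [le_div_iff₀ (by positivity)] at ht
    rw [div_le_iff₀ hδ]
    nlinarith
  have hcoarse : ∀ᶠ t in atTop, W' t ≤ -(δ / 2) * D t - γ / 8 * ε t * ‖u t - p‖ ^ 2 +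
      (γ / 2 * ‖p‖ ^ 2 + 1) * ε t := by
    filter_upwards [hsmall (γ * δ / 4) (by positivity), hsq 1 one_pos, eventually_gt_atTop 0]
      with t ht hsqt ht0
    have h := hdiss t ht0 (by linarith)
    have h' := neg_le_of_abs_le (abs_real_inner_le_norm p (u t - p))
    have h'' : -⟪p, u t - p⟫ ≤ ‖p‖ ^ 2 + 1 / 4 * ‖u t - p‖ ^ 2 := by
      nlinarith [sq_nonneg (‖p‖ - 1 / 2 * ‖u t - p‖)]
    have h₃ := mul_le_mul_of_nonneg_left h''
      (mul_nonneg (half_pos hγ).le (hεpos t ht0.le).le)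
    linarith
  obtain ⟨R, hR⟩ : ∃ R, ∀ᶠ t in atTop, ‖u t‖ ≤ R := by
    have h := eventually_le_add_of_hasDerivAt_le (M := (γ / 2 * ‖p‖ ^ 2 + 1) / κ) hg hG hκ hder
      (by
        filter_upwards [hcoarse, hsmall 1 one_pos, eventually_gt_atTop 0] with t hc hε1 ht0
        rw [hgε t ht0.le]
        have h := hκW t ht0.le hε1
        have h' : κ * ε t * ((γ / 2 * ‖p‖ ^ 2 + 1) / κ) = (γ / 2 * ‖p‖ ^ 2 + 1) * ε t := by
          field_simp
        linarith [mul_nonneg hδ.le (hDnn t)]) one_pos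
    refine ⟨√(((γ / 2 * ‖p‖ ^ 2 + 1) / κ + 1) / (γ ^ 2 / 8)) + ‖p‖, ?_⟩
    filter_upwards [h] with t ht
    have h₁ : ‖u t - p‖ ≤ √(((γ / 2 * ‖p‖ ^ 2 + 1) / κ + 1) / (γ ^ 2 / 8)) := by
      refine Real.le_sqrt_of_sq_le ?_
      rw [le_div_iff₀' (by positivity)]
      exact (hlower t).trans ht
    have h₂ := norm_add_le (u t - p) p
    rw [sub_add_cancel] at h₂
    linarith
  have hWlim : ∀ η > 0, ∀ᶠ t in atTop, W t ≤ η := by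
    intro η hη
    obtain ⟨θ, hθ, hθη⟩ := exists_pos_forall_neg_inner_le hφconv hφgrad hAmax hlam hAcoco hp hpmin
      R (η := κ * η / (2 * γ)) (by positivity)
    have h := eventually_le_add_of_hasDerivAt_le (M := η / 2) hg hG hκ hder
      (by
        filter_upwards [hcoarse, hsmall 1 one_pos, hsq (κ * η / 4) (by positivity), hR,
          hsmall (γ * δ / 4) (by positivity),
          hsmall (δ / 4 * θ / (γ / 2 * ‖p‖ ^ 2 + 1)) (by positivity), eventually_gt_atTop 0]
          with t hc hε1 hsqt hRt hεδ hεθ ht0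
        rw [hgε t ht0.le]
        have hκWt := hκW t ht0.le hε1
        have he := (hεpos t ht0.le).le
        by_cases hDθ : D t ≤ θ
        · have hDt : D t = ‖u' t‖ ^ 2 + ‖A (u t) - A p‖ ^ 2 + P t := by rw [hD]
          have hPt : P t = φ (u t) - φ p - ⟪φ' p, u t - p⟫ := by rw [hPdef]
          have hin := hθη (u t) hRt (by linarith [hP t, sq_nonneg ‖u' t‖])
            (by linarith [sq_nonneg ‖u' t‖, sq_nonneg ‖A (u t) - A p‖])
          have hin' := mul_le_mul_of_nonneg_left hin (mul_nonneg (half_pos hγ).le he)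
          have hin'' : γ / 2 * ε t * (κ * η / (2 * γ)) = κ * η / 4 * ε t := by
            field_simp
            ring
          have hd := hdiss t ht0 (by linarith)
          have hw : 0 ≤ γ / 8 * ε t * ‖u t - p‖ ^ 2 := by positivity
          linarith [mul_nonneg hδ.le (hDnn t)]
        · rw [le_div_iff₀ (by positivity)] at hεθ
          have hδθ := mul_le_mul_of_nonneg_left (not_le.1 hDθ).le hδ.le
          have hκη : 0 ≤ κ * ε t * (η / 2) := by positivity
          linarith) (half_pos hη)
    filter_upwards [h] with t ht
    linarith
  rw [Metric.tendsto_nhds]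
  intro r hr
  filter_upwards [hWlim (γ ^ 2 / 16 * r ^ 2) (by positivity)] with t ht
  rw [dist_eq_norm]
  refine lt_of_pow_lt_pow_left₀ 2 hr.le ?_
  have h := (hlower t).trans ht
  have hr2 : 0 < γ ^ 2 / 16 * r ^ 2 := by positivity
  refine lt_of_mul_lt_mul_left ?_ (show 0 ≤ γ ^ 2 / 8 by positivity)
  linarith
end
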